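/- arXiv:1908.08444 — 4 statements merged into one kernel-verified Lean document; each statement's English description precedes it below -/
import Mathlib

section
/- Let Θ = (Θ_1,...,Θ_m) ∈ ℝ^m be fixed, Y_1,...,Y_m independent with Y_i having density p̃(·;Θ_i), A a measurable action space and L : A × ℝ → [0,∞) a measurable loss. Suppose δ̃* : ℝ → A is measurable and, for Lebesgue-almost every z, δ̃*(z) minimizes a ↦ Σ_{i=1}^m L(a,Θ_i) p̃(z;Θ_i) over a ∈ A. Then for EVERY measurable Γ ⊆ ℝ and every measurable δ̃ : ℝ → A, E[(1/m) Σ_{i=1}^m L(δ̃*(Y_i),Θ_i) 1(Y_i ∈ Γ)] ≤ E[(1/m) Σ_{i=1}^m L(δ̃(Y_i),Θ_i) 1(Y_i ∈ Γ)]; i.e. the unadjusted Bayes rule is the optimal separable rule for the selective compound risk, regardless of the (marginal) selection region Γ. -/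
open MeasureTheory ENNReal

/-- The expectation of a sum of functions of the individual coordinates of independent random
variables with densities `f i` is the integral of the density-weighted sum. -/
theorem lintegral_pi_withDensity_sum_eval {ι : Type*} [Fintype ι]
    (f : ι → ℝ → ℝ≥0∞) (hf : ∀ i, Measurable (f i)) (hf1 : ∀ i, ∫⁻ z, f i z = 1)
    (g : ι → ℝ → ℝ≥0∞) (hg : ∀ i, Measurable (g i)) :
    ∫⁻ y, ∑ i, g i (y i) ∂(Measure.pi fun i => volume.withDensity (f i))
      = ∫⁻ z, ∑ i, g i z * f i z := by
  have hprob (i : ι) : IsProbabilityMeasure (volume.withDensity (f i)) :=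
    ⟨by rw [withDensity_apply _ .univ, Measure.restrict_univ, hf1 i]⟩
  rw [lintegral_finsetSum _ fun i _ => by fun_prop,
    lintegral_finsetSum _ fun i _ => by fun_prop]
  refine Finset.sum_congr rfl fun i _ => ?_
  rw [(measurePreserving_eval (fun i => volume.withDensity (f i)) i).lintegral_comp (hg i),
    lintegral_withDensity_eq_lintegral_mul _ (hf i) (hg i)]
  simp only [Pi.mul_apply, mul_comm]

/-- The unadjusted Bayes rule is the optimal separable rule for the
selective compound risk, regardless of the marginal selection region: if the
measurable rule `δ*` minimizes `a ↦ ∑ i, L a (Θ i) * p z (Θ i)` at Lebesgue-almost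
every `z`, then for EVERY measurable `Γ ⊆ ℝ` and every measurable `δ`,
`E[(1/m) ∑ i, L(δ*(Y i), Θ i) 1(Y i ∈ Γ)] ≤ E[(1/m) ∑ i, L(δ(Y i), Θ i) 1(Y i ∈ Γ)]`,
the `Y i` being independent with density `p · (Θ i)` w.r.t. Lebesgue measure. -/
theorem bayes_rule_optimal_for_selective_risk
    {A : Type*} [MeasurableSpace A]
    (m : ℕ) (hm : 0 < m) (Θ : Fin m → ℝ)
    (p : ℝ → ℝ → ℝ≥0∞)
    (hp : Measurable (Function.uncurry p))
    (hpdens : ∀ i, ∫⁻ z, p z (Θ i) = 1)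
    (L : A → ℝ → NNReal)
    (hL : Measurable (fun q : A × ℝ => L q.1 q.2))
    (δstar : ℝ → A) (hδstar : Measurable δstar)
    (hmin : ∀ᵐ z ∂(volume : Measure ℝ), ∀ a : A,
      ∑ i : Fin m, (L (δstar z) (Θ i) : ℝ≥0∞) * p z (Θ i)
        ≤ ∑ i : Fin m, (L a (Θ i) : ℝ≥0∞) * p z (Θ i)) :
    ∀ Γ : Set ℝ, MeasurableSet Γ → ∀ δ : ℝ → A, Measurable δ →
      (∫⁻ y, (m : ℝ≥0∞)⁻¹ * ∑ i : Fin m,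
          (L (δstar (y i)) (Θ i) : ℝ≥0∞) * Γ.indicator (fun _ => 1) (y i)
          ∂(Measure.pi fun i : Fin m => volume.withDensity (fun z => p z (Θ i))))
      ≤ (∫⁻ y, (m : ℝ≥0∞)⁻¹ * ∑ i : Fin m,
          (L (δ (y i)) (Θ i) : ℝ≥0∞) * Γ.indicator (fun _ => 1) (y i)
          ∂(Measure.pi fun i : Fin m => volume.withDensity (fun z => p z (Θ i)))) := by
  intro Γ hΓ δ hδ
  have hpΘ (i : Fin m) : Measurable fun z => p z (Θ i) :=
    hp.comp (measurable_id.prodMk measurable_const)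
  have hloss (d : ℝ → A) (hd : Measurable d) (i : Fin m) :
      Measurable fun z => (L (d z) (Θ i) : ℝ≥0∞) * Γ.indicator (fun _ => 1) z :=
    (hL.comp (hd.prodMk measurable_const)).coe_nnreal_ennreal.mul
      (measurable_const.indicator hΓ)
  have hrisk (d : ℝ → A) (hd : Measurable d) :=
    lintegral_pi_withDensity_sum_eval (fun i z => p z (Θ i)) hpΘ hpdens _ (hloss d hd)
  have hm' : (m : ℝ≥0∞)⁻¹ ≠ ∞ := ENNReal.inv_ne_top.2 (Nat.cast_ne_zero.2 hm.ne')
  rw [lintegral_const_mul' _ _ hm', lintegral_const_mul' _ _ hm', hrisk _ hδstar, hrisk _ hδ]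
  refine mul_le_mul_right (lintegral_mono_ae ?_) _
  filter_upwards [hmin] with z hz
  simp only [mul_right_comm _ (Γ.indicator _ z), ← Finset.sum_mul]
  exact mul_le_mul_left (hz (δ z)) _
end

section
/- Let Θ = (Θ_1,...,Θ_m) ∈ ℝ^m be fixed with at least one Θ_i ≤ 0 and at least one Θ_i > 0, let Y_1,...,Y_m be independent with Y_i having density p̃(·;Θ_i), and let (Z,Ω) have the mixture distribution ν = (1/m) Σ_{i=1}^m Law(Y_i,Θ_i). Define fdr(z) = Σ_{i:Θ_i≤0} p̃(z;Θ_i) / Σ_{i=1}^m p̃(z;Θ_i). Fix c ∈ (0,1) and let δ*(z) = 1(fdr(z) ≤ c) with P(δ*(Z)=1) > 0. Then for every measurable δ : ℝ → {0,1} with P(δ(Z)=1) > 0 and mFDR(δ) := P(Ω ≤ 0 | δ(Z)=1) ≤ P(Ω ≤ 0 | δ*(Z)=1) =: mFDR(δ*), one has mMDR(δ*) := P(δ*(Z)=0 | Ω > 0) ≤ P(δ(Z)=0 | Ω > 0) =: mMDR(δ); i.e. among all separable tests with smaller or equal mFDR, the fdr-thresholding rule has minimum mMDR. -/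
open MeasureTheory ENNReal

lemma not_ratio_le_of_threshold_exchange {c nD nE nI tD tE tI : ℝ}
    (hc1 : c < 1) (htE : 0 ≤ tE) (htI : 0 ≤ tI)
    (hD : c * (nD + tD) < nD) (hE : nE ≤ c * (nE + tE)) (hI : nI ≤ c * (nI + tI))
    (ht : tE < tD) (hpos : 0 < (nE + tE) + (nI + tI)) :
    ¬ (nD + nI) * (tE + tI) ≤ (nE + nI) * (tD + tI) := by
  intro h
  have hk : 0 < 1 - c := by linarith
  have hgap : 0 < (1 - c) * nD - c * tD := by linarith
  have hE' : 0 ≤ c * tE - (1 - c) * nE := by linarith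
  have hI' : 0 ≤ c * tI - (1 - c) * nI := by linarith
  have htot : 0 < tE + tI := by
    by_contra hle
    have h1 : tE = 0 := by linarith
    have h2 : tI = 0 := by linarith
    subst h1 h2
    nlinarith
  have hmul := mul_le_mul_of_nonneg_left h hk.le
  have e1 := mul_pos htot hgap
  have e2 := mul_nonneg (by linarith : (0 : ℝ) ≤ tD + tI) hE'
  have e3 := mul_nonneg (by linarith : (0 : ℝ) ≤ tD - tE) hI'
  nlinarith

/-- A Neyman–Pearson lemma for ratio constraints: thresholding `a / (a + b)` maximizes the
`b`-mass among all sets whose `a`-fraction is no larger. -/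
lemma setLIntegral_le_of_ratio_le_threshold {α : Type*} [MeasurableSpace α] {μ : Measure α}
    {a b : α → ℝ≥0∞} (ha : Measurable a) (hb : Measurable b)
    (hai : ∫⁻ z, a z ∂μ ≠ ⊤) (hbi : ∫⁻ z, b z ∂μ ≠ ⊤)
    {A B : Set α} (hA : MeasurableSet A) (hB : MeasurableSet B)
    {c : ℝ≥0∞} (hc1 : c < 1)
    (hle : ∀ z ∈ B, a z ≤ c * (a z + b z)) (hlt : ∀ z ∉ B, c * (a z + b z) < a z)
    (hApos : ∫⁻ z in A, (a z + b z) ∂μ ≠ 0) (hBpos : ∫⁻ z in B, (a z + b z) ∂μ ≠ 0)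
    (hratio : (∫⁻ z in A, a z ∂μ) / ∫⁻ z in A, (a z + b z) ∂μ
      ≤ (∫⁻ z in B, a z ∂μ) / ∫⁻ z in B, (a z + b z) ∂μ) :
    ∫⁻ z in A, b z ∂μ ≤ ∫⁻ z in B, b z ∂μ := by
  have fa (S : Set α) : ∫⁻ z in S, a z ∂μ ≠ ⊤ :=
    ne_top_of_le_ne_top hai (setLIntegral_le_lintegral _ _)
  have fb (S : Set α) : ∫⁻ z in S, b z ∂μ ≠ ⊤ :=
    ne_top_of_le_ne_top hbi (setLIntegral_le_lintegral _ _)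
  have hctop : c ≠ ⊤ := (hc1.trans one_lt_top).ne
  have sab (S : Set α) : ∫⁻ z in S, (a z + b z) ∂μ
      = ∫⁻ z in S, a z ∂μ + ∫⁻ z in S, b z ∂μ := lintegral_add_left ha _
  have scab (S : Set α) : ∫⁻ z in S, c * (a z + b z) ∂μ
      = c * (∫⁻ z in S, a z ∂μ + ∫⁻ z in S, b z ∂μ) := by
    rw [← sab]
    exact lintegral_const_mul _ (ha.add hb)
  by_contra! hcon
  have splitA (f : α → ℝ≥0∞) :
      ∫⁻ z in A, f z ∂μ = ∫⁻ z in A \ B, f z ∂μ + ∫⁻ z in A ∩ B, f z ∂μ := by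
    rw [add_comm, lintegral_inter_add_sdiff f A hB]
  have splitB (f : α → ℝ≥0∞) :
      ∫⁻ z in B, f z ∂μ = ∫⁻ z in B \ A, f z ∂μ + ∫⁻ z in A ∩ B, f z ∂μ := by
    rw [add_comm, Set.inter_comm, lintegral_inter_add_sdiff f B hA]
  have hb_lt : ∫⁻ z in B \ A, b z ∂μ < ∫⁻ z in A \ B, b z ∂μ := by
    rw [splitA b, splitB b] at hcon
    exact lt_of_add_lt_add_right hcon
  have hD : c * (∫⁻ z in A \ B, a z ∂μ + ∫⁻ z in A \ B, b z ∂μ) < ∫⁻ z in A \ B, a z ∂μ := by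
    rw [← scab]
    refine setLIntegral_strict_mono (hA.diff hB) ?_ ha ?_ ?_
    · intro h0
      rw [setLIntegral_measure_zero _ _ h0] at hb_lt
      exact not_lt_bot hb_lt
    · rw [scab]
      exact mul_ne_top hctop (add_ne_top.2 ⟨fa _, fb _⟩)
    · exact ae_of_all _ fun z hz => hlt z hz.2
  have hEI (S : Set α) (hS : MeasurableSet S) (hSB : S ⊆ B) :
      ∫⁻ z in S, a z ∂μ ≤ c * (∫⁻ z in S, a z ∂μ + ∫⁻ z in S, b z ∂μ) := by
    rw [← scab]
    exact setLIntegral_mono' hS fun z hz => hle z (hSB hz)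
  have hE := hEI (B \ A) (hB.diff hA) Set.sdiff_subset
  have hI := hEI (A ∩ B) (hA.inter hB) Set.inter_subset_right
  rw [sab] at hApos hBpos
  rw [sab, sab] at hratio
  rw [splitA a, splitA b] at hApos hratio
  rw [splitB a, splitB b] at hBpos hratio
  have fa1 := fa (A \ B)
  have fa2 := fa (B \ A)
  have fa3 := fa (A ∩ B)
  have fb1 := fb (A \ B)
  have fb2 := fb (B \ A)
  have fb3 := fb (A ∩ B)
  generalize ∫⁻ z in A \ B, a z ∂μ = nD at *
  generalize ∫⁻ z in B \ A, a z ∂μ = nE at *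
  generalize ∫⁻ z in A ∩ B, a z ∂μ = nI at *
  generalize ∫⁻ z in A \ B, b z ∂μ = tD at *
  generalize ∫⁻ z in B \ A, b z ∂μ = tE at *
  generalize ∫⁻ z in A ∩ B, b z ∂μ = tI at *
  lift nD to NNReal using fa1
  lift nE to NNReal using fa2
  lift nI to NNReal using fa3
  lift tD to NNReal using fb1
  lift tE to NNReal using fb2
  lift tI to NNReal using fb3
  lift c to NNReal using hctop
  norm_cast at hc1 hb_lt hD hE hI hApos hBpos
  rw [← coe_add, ← coe_add, ← coe_add, ← coe_add, ← coe_add, ← coe_add,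
    ← coe_div hApos, ← coe_div hBpos, coe_le_coe] at hratio
  rw [div_le_div_iff₀ (pos_of_ne_zero hApos) (pos_of_ne_zero hBpos)] at hratio
  have hBpos' := pos_of_ne_zero hBpos
  rw [← NNReal.coe_lt_coe] at hc1 hb_lt hD hBpos'
  rw [← NNReal.coe_le_coe] at hE hI hratio
  push_cast at hc1 hb_lt hD hBpos' hE hI hratio
  refine not_ratio_le_of_threshold_exchange hc1 tE.coe_nonneg tI.coe_nonneg hD hE hI hb_lt ?_ ?_
  · linarith
  · linarith

/-- The mixture mass of a measurable set is the average of the component masses of its slices. -/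
lemma smul_sum_map_withDensity_apply {m : ℕ} (Θ : Fin m → ℝ) (p : ℝ → ℝ → ℝ≥0∞)
    {S : Set (ℝ × ℝ)} (hS : MeasurableSet S) :
    ((m : ℝ≥0∞)⁻¹ • ∑ i : Fin m,
      (volume.withDensity (fun z => p z (Θ i))).map (fun z => (z, Θ i))) S
      = (m : ℝ≥0∞)⁻¹ * ∑ i : Fin m, ∫⁻ z in {z | (z, Θ i) ∈ S}, p z (Θ i) := by
  have hmk (i : Fin m) : Measurable fun z : ℝ => (z, Θ i) := by fun_prop
  simp only [Measure.smul_apply, Measure.finsetSum_apply, smul_eq_mul]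
  congr 1
  refine Finset.sum_congr rfl fun i _ => ?_
  rw [Measure.map_apply (hmk i) hS, withDensity_apply _ (hmk i hS)]
  rfl

lemma mixture_apply_slice {m : ℕ} (Θ : Fin m → ℝ) {p : ℝ → ℝ → ℝ≥0∞}
    (hp : Measurable (Function.uncurry p)) {A : Set ℝ} (hA : MeasurableSet A)
    (P : ℝ → Prop) [DecidablePred P] (hP : MeasurableSet {t | P t}) :
    ((m : ℝ≥0∞)⁻¹ • ∑ i : Fin m,
      (volume.withDensity (fun z => p z (Θ i))).map (fun z => (z, Θ i)))
        {q : ℝ × ℝ | q.1 ∈ A ∧ P q.2}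
      = (m : ℝ≥0∞)⁻¹ * ∫⁻ z in A, ∑ i : Fin m, if P (Θ i) then p z (Θ i) else 0 := by
  have hpm (i : Fin m) : Measurable fun z => p z (Θ i) :=
    hp.comp (measurable_id.prodMk measurable_const)
  have hS : MeasurableSet {q : ℝ × ℝ | q.1 ∈ A ∧ P q.2} := hA.prod hP
  rw [smul_sum_map_withDensity_apply Θ p hS,
    lintegral_finsetSum _ fun i _ => by split_ifs; exacts [hpm i, measurable_const]]
  congr 1
  refine Finset.sum_congr rfl fun i _ => ?_
  by_cases h : P (Θ i) <;> simp [h]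

/-- Optimality of fdr-thresholding among separable tests: with
fixed `Θ : Fin m → ℝ` having at least one `Θ i ≤ 0` and at least one `Θ i > 0`,
independent `Y i` with densities `p · (Θ i)`, mixture law `ν = (1/m) ∑ i Law(Y i, Θ i)`
of the pair `(Z, Ω)`, `fdr z = ∑_{i : Θ i ≤ 0} p(z; Θ i) / ∑ i p(z; Θ i)`,
`c ∈ (0,1)`, and `δ*(z) = 1(fdr z ≤ c)` with `P(δ*(Z) = 1) > 0`: every measurable
test `δ : ℝ → Bool` with `P(δ(Z) = 1) > 0` and
`mFDR(δ) = P(Ω ≤ 0 | δ(Z) = 1) ≤ P(Ω ≤ 0 | δ*(Z) = 1) = mFDR(δ*)` satisfies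
`mMDR(δ*) = P(δ*(Z) = 0 | Ω > 0) ≤ P(δ(Z) = 0 | Ω > 0) = mMDR(δ)`. -/
theorem fdr_thresholding_minimizes_mMDR_subject_to_mFDR
    (m : ℕ) (hm : 0 < m) (Θ : Fin m → ℝ)
    (h0 : ∃ i, Θ i ≤ 0) (h1 : ∃ i, 0 < Θ i)
    (p : ℝ → ℝ → ℝ≥0∞)
    (hp : Measurable (Function.uncurry p))
    (hpdens : ∀ i, ∫⁻ z, p z (Θ i) = 1)
    (ν : Measure (ℝ × ℝ))
    (hν : ν = (m : ℝ≥0∞)⁻¹ •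
      ∑ i : Fin m, (volume.withDensity (fun z => p z (Θ i))).map (fun z => (z, Θ i)))
    (fdr : ℝ → ℝ≥0∞)
    (hfdr : ∀ z, fdr z =
      (∑ i : Fin m, if Θ i ≤ 0 then p z (Θ i) else 0) / ∑ i : Fin m, p z (Θ i))
    (c : ℝ≥0∞) (hc0 : 0 < c) (hc1 : c < 1)
    (δstar : ℝ → Bool) (hδstarMeas : Measurable δstar)
    (hδstar : ∀ z, δstar z = true ↔ fdr z ≤ c)
    (hstarpos : 0 < ν {q : ℝ × ℝ | δstar q.1 = true}) :
    ∀ δ : ℝ → Bool, Measurable δ →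
      0 < ν {q : ℝ × ℝ | δ q.1 = true} →
      ν {q : ℝ × ℝ | q.2 ≤ 0 ∧ δ q.1 = true} / ν {q : ℝ × ℝ | δ q.1 = true}
        ≤ ν {q : ℝ × ℝ | q.2 ≤ 0 ∧ δstar q.1 = true} / ν {q : ℝ × ℝ | δstar q.1 = true} →
      ν {q : ℝ × ℝ | δstar q.1 = false ∧ 0 < q.2} / ν {q : ℝ × ℝ | 0 < q.2}
        ≤ ν {q : ℝ × ℝ | δ q.1 = false ∧ 0 < q.2} / ν {q : ℝ × ℝ | 0 < q.2} := by
  intro δ hδ hδpos hratio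
  classical
  set a : ℝ → ℝ≥0∞ := fun z => ∑ i : Fin m, if Θ i ≤ 0 then p z (Θ i) else 0 with ha_def
  set b : ℝ → ℝ≥0∞ := fun z => ∑ i : Fin m, if 0 < Θ i then p z (Θ i) else 0 with hb_def
  have hpm (i : Fin m) : Measurable fun z => p z (Θ i) :=
    hp.comp (measurable_id.prodMk measurable_const)
  have ha : Measurable a := Finset.measurable_sum _ fun i _ => by
    split_ifs; exacts [hpm i, measurable_const]
  have hb : Measurable b := Finset.measurable_sum _ fun i _ => by
    split_ifs; exacts [hpm i, measurable_const]
  have hab (z : ℝ) : ∑ i : Fin m, p z (Θ i) = a z + b z := by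
    rw [ha_def, hb_def, ← Finset.sum_add_distrib]
    refine Finset.sum_congr rfl fun i _ => ?_
    rcases le_or_gt (Θ i) 0 with h | h
    · simp [h, h.not_gt]
    · simp [h, h.not_ge]
  have hfin : ∫⁻ z, (a z + b z) ≠ ⊤ := by
    simp_rw [← hab]
    rw [lintegral_finsetSum _ fun i _ => hpm i]
    simp [hpdens]
  have hai : ∫⁻ z, a z ≠ ⊤ :=
    ne_top_of_le_ne_top hfin (lintegral_mono fun z => le_self_add)
  have hbi : ∫⁻ z, b z ≠ ⊤ :=
    ne_top_of_le_ne_top hfin (lintegral_mono fun z => le_add_self)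
  have hA {d : ℝ → Bool} (hd : Measurable d) (v : Bool) : MeasurableSet {z | d z = v} :=
    hd (measurableSet_singleton v)
  have hnull {d : ℝ → Bool} (hd : Measurable d) : ν {q : ℝ × ℝ | q.2 ≤ 0 ∧ d q.1 = true}
      = (m : ℝ≥0∞)⁻¹ * ∫⁻ z in {z | d z = true}, a z := by
    rw [hν, ← mixture_apply_slice Θ hp (hA hd true) (· ≤ 0) measurableSet_Iic]
    simp only [Set.mem_ofPred_eq, and_comm]
  have hreject {d : ℝ → Bool} (hd : Measurable d) : ν {q : ℝ × ℝ | d q.1 = true}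
      = (m : ℝ≥0∞)⁻¹ * ∫⁻ z in {z | d z = true}, (a z + b z) := by
    have h := mixture_apply_slice Θ hp (hA hd true) (fun _ => True) MeasurableSet.univ
    simpa only [and_true, if_true, hab, ← hν, Set.mem_ofPred_eq] using h
  have hmiss {d : ℝ → Bool} (hd : Measurable d) : ν {q : ℝ × ℝ | d q.1 = false ∧ 0 < q.2}
      = (m : ℝ≥0∞)⁻¹ * ∫⁻ z in {z | d z = false}, b z := by
    rw [hν, ← mixture_apply_slice Θ hp (hA hd false) (0 < ·) measurableSet_Ioi]
    rfl
  have hm0 : (m : ℝ≥0∞)⁻¹ ≠ 0 := ENNReal.inv_ne_zero.2 (natCast_ne_top m)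
  have hmt : (m : ℝ≥0∞)⁻¹ ≠ ⊤ := ENNReal.inv_ne_top.2 (by exact_mod_cast hm.ne')
  rw [hreject hδ] at hδpos
  rw [hreject hδstarMeas] at hstarpos
  rw [hnull hδ, hreject hδ, hnull hδstarMeas, hreject hδstarMeas,
    ENNReal.mul_div_mul_left _ _ hm0 hmt, ENNReal.mul_div_mul_left _ _ hm0 hmt] at hratio
  have hfdr' (z : ℝ) : fdr z = a z / (a z + b z) := by rw [hfdr, hab]
  have key : ∫⁻ z in {z | δ z = true}, b z ≤ ∫⁻ z in {z | δstar z = true}, b z := by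
    refine setLIntegral_le_of_ratio_le_threshold ha hb hai hbi (hA hδ true)
      (hA hδstarMeas true) hc1 ?_ ?_ (right_ne_zero_of_mul hδpos.ne')
      (right_ne_zero_of_mul hstarpos.ne') hratio
    · intro z hz
      have h := (hδstar z).1 hz
      rw [hfdr'] at h
      exact (ENNReal.div_le_iff_le_mul (Or.inr (hc1.trans one_lt_top).ne) (Or.inr hc0.ne')).1 h
    · intro z hz
      have h : c < a z / (a z + b z) := by
        rw [← hfdr']
        exact not_le.1 fun hle => hz ((hδstar z).2 hle)
      exact ENNReal.mul_lt_of_lt_div h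
  have hcompl (d : ℝ → Bool) : {z | d z = false} = {z | d z = true}ᶜ := by
    ext z; simp
  rw [hmiss hδ, hmiss hδstarMeas, hcompl, hcompl]
  refine ENNReal.div_le_div_right (mul_le_mul_right ?_ _) _
  have e1 := lintegral_add_compl (μ := volume) b (hA hδ true)
  have e2 := lintegral_add_compl (μ := volume) b (hA hδstarMeas true)
  have hstar_fin : ∫⁻ z in {z | δstar z = true}, b z ≠ ⊤ :=
    ne_top_of_le_ne_top hbi (setLIntegral_le_lintegral _ _)
  refine (ENNReal.add_le_add_iff_left hstar_fin).1 ?_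
  rw [e2, ← e1]
  gcongr
end

section
/- Let Θ_1,...,Θ_m ∈ ℝ with at least one Θ_i ≤ 0, and define for z ∈ ℝ the local false discovery rate under the normal sequence model: fdr(z) = Σ_{i:Θ_i≤0} exp(−(z−Θ_i)²/2) / Σ_{i=1}^m exp(−(z−Θ_i)²/2). Then fdr is nonincreasing on ℝ: for all z ≤ z', fdr(z') ≤ fdr(z). Moreover, if in addition at least one Θ_j > 0, then fdr is strictly decreasing: z < z' implies fdr(z') < fdr(z). -/
/-- The strict monotone likelihood ratio property of the normal location family. -/
lemma exp_neg_sq_mul_lt_of_lt {a b z z' : ℝ} (hab : a < b) (hz : z < z') :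
    Real.exp (-(z' - a) ^ 2 / 2) * Real.exp (-(z - b) ^ 2 / 2) <
      Real.exp (-(z - a) ^ 2 / 2) * Real.exp (-(z' - b) ^ 2 / 2) := by
  rw [← Real.exp_add, ← Real.exp_add, Real.exp_lt_exp]
  nlinarith [mul_pos (sub_pos.2 hab) (sub_pos.2 hz)]

/-- If every location in `s` lies below every location in `t`, then the mixture of the unit normal
densities over `s` and the one over `t` have a strictly monotone likelihood ratio. -/
lemma sum_exp_neg_sq_mul_sum_lt {ι : Type*} {s t : Finset ι} (hs : s.Nonempty) (ht : t.Nonempty)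
    {Θ : ι → ℝ} (hst : ∀ i ∈ s, ∀ j ∈ t, Θ i < Θ j) {z z' : ℝ} (hz : z < z') :
    (∑ i ∈ s, Real.exp (-(z' - Θ i) ^ 2 / 2)) * (∑ j ∈ t, Real.exp (-(z - Θ j) ^ 2 / 2)) <
      (∑ i ∈ s, Real.exp (-(z - Θ i) ^ 2 / 2)) * ∑ j ∈ t, Real.exp (-(z' - Θ j) ^ 2 / 2) := by
  rw [Finset.sum_mul_sum, Finset.sum_mul_sum]
  exact Finset.sum_lt_sum_of_nonempty hs fun i hi =>
    Finset.sum_lt_sum_of_nonempty ht fun j hj => exp_neg_sq_mul_lt_of_lt (hst i hi j hj) hz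


/-- Monotonicity of the local false discovery rate in the normal
means model: with `Θ : Fin m → ℝ` having at least one `Θ i ≤ 0`, and
`fdr z = ∑_{i : Θ i ≤ 0} exp(−(z − Θ i)²/2) / ∑_i exp(−(z − Θ i)²/2)`,
`fdr` is nonincreasing on `ℝ`; if in addition some `Θ j > 0`, it is strictly
decreasing. -/
theorem normal_local_fdr_monotone
    (m : ℕ) (hm : 0 < m) (Θ : Fin m → ℝ)
    (h0 : ∃ i, Θ i ≤ 0)
    (fdr : ℝ → ℝ)
    (hfdr : ∀ z, fdr z =
      (∑ i : Fin m, if Θ i ≤ 0 then Real.exp (-(z - Θ i) ^ 2 / 2) else 0)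
        / ∑ i : Fin m, Real.exp (-(z - Θ i) ^ 2 / 2)) :
    (∀ z z', z ≤ z' → fdr z' ≤ fdr z) ∧
    ((∃ j, 0 < Θ j) → ∀ z z', z < z' → fdr z' < fdr z) := by
  classical
  have hsplit (z : ℝ) := Finset.sum_filter_add_sum_filter_not Finset.univ (fun i => Θ i ≤ 0)
    (fun i => Real.exp (-(z - Θ i) ^ 2 / 2))
  have hs : (Finset.univ.filter fun i => Θ i ≤ 0).Nonempty :=
    h0.imp fun i hi => by simpa using hi
  have hpos (z : ℝ) : 0 < ∑ i with Θ i ≤ 0, Real.exp (-(z - Θ i) ^ 2 / 2) :=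
    Finset.sum_pos (fun _ _ => Real.exp_pos _) hs
  have hnonneg (z : ℝ) : 0 ≤ ∑ i with ¬ Θ i ≤ 0, Real.exp (-(z - Θ i) ^ 2 / 2) :=
    Finset.sum_nonneg fun _ _ => (Real.exp_pos _).le
  have hstrict : (∃ j, 0 < Θ j) → ∀ z z', z < z' → fdr z' < fdr z := by
    intro hj z z' hz
    have ht : (Finset.univ.filter fun i => ¬ Θ i ≤ 0).Nonempty :=
      hj.imp fun j hj => by simpa using hj
    have key := sum_exp_neg_sq_mul_sum_lt hs ht (Θ := Θ) (fun i hi j hj => by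
      simp only [Finset.mem_filter, Finset.mem_univ, true_and, not_le] at hi hj
      exact hi.trans_lt hj) hz
    rw [hfdr, hfdr, ← Finset.sum_filter, ← Finset.sum_filter, ← hsplit z, ← hsplit z',
      div_lt_div_iff₀ (add_pos_of_pos_of_nonneg (hpos z') (hnonneg z'))
        (add_pos_of_pos_of_nonneg (hpos z) (hnonneg z))]
    linarith
  refine ⟨fun z z' hz => ?_, hstrict⟩
  by_cases hj : ∃ j, 0 < Θ j
  · rcases hz.eq_or_lt with rfl | hlt
    · exact le_rfl
    · exact (hstrict hj z z' hlt).le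
  · push Not at hj
    have hone (z : ℝ) : fdr z = 1 := by
      have hz := hpos z
      simp only [hj, Finset.filter_true] at hz
      simp only [hfdr, hj, if_true]
      exact div_self hz.ne'
    rw [hone, hone]
end

section
/- Let Θ_1,...,Θ_m ∈ ℝ with at least one Θ_i ≤ 0, let Φ̄(x) = 1 − Φ(x) where Φ is the standard normal cumulative distribution function, and define the tail false discovery rate Fdr(y) = Σ_{i:Θ_i≤0} Φ̄(y − Θ_i) / Σ_{i=1}^m Φ̄(y − Θ_i) for y ∈ ℝ. Then Fdr is nonincreasing on ℝ: for all y ≤ y', Fdr(y') ≤ Fdr(y). Moreover, if at least one Θ_j > 0, then Fdr is strictly decreasing. -/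
open MeasureTheory

/-- The standard normal density. -/
private noncomputable def gaussDensity (t : ℝ) : ℝ :=
  Real.exp (-t ^ 2 / 2) / Real.sqrt (2 * Real.pi)

private lemma gaussDensity_pos (t : ℝ) : 0 < gaussDensity t := by
  unfold gaussDensity
  positivity

private lemma continuous_gaussDensity : Continuous gaussDensity := by
  unfold gaussDensity
  fun_prop

private lemma integrable_gaussDensity : Integrable gaussDensity := by
  have h := (integrable_exp_neg_mul_sq (b := 1 / 2) (by norm_num)).div_const
    (Real.sqrt (2 * Real.pi))
  refine h.congr (Filter.Eventually.of_forall fun t => ?_)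
  simp only [gaussDensity]
  ring_nf

private lemma integral_gaussDensity : ∫ t, gaussDensity t = 1 := by
  have h := integral_gaussian (1 / 2)
  have e : ∀ t : ℝ, Real.exp (-t ^ 2 / 2) = Real.exp (-(1 / 2) * t ^ 2) := fun t => by ring_nf
  simp only [gaussDensity, integral_div, e, h]
  rw [show Real.pi / (1 / 2) = 2 * Real.pi by ring]
  exact div_self (by positivity)

private lemma gaussDensity_add (t d : ℝ) :
    gaussDensity (t + d) = Real.exp (-t * d - d ^ 2 / 2) * gaussDensity t := by
  simp only [gaussDensity]
  rw [← mul_div_assoc, ← Real.exp_add]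
  ring_nf

/-- The upper tail of the standard normal distribution. -/
private noncomputable def gaussTail (x : ℝ) : ℝ := ∫ t in Set.Ioi x, gaussDensity t

private lemma one_sub_integral_Iic_gaussDensity (x : ℝ) :
    1 - ∫ t in Set.Iic x, gaussDensity t = gaussTail x := by
  have h := integral_add_compl (measurableSet_Iic (a := x)) integrable_gaussDensity
  rw [integral_gaussDensity, Set.compl_Iic] at h
  unfold gaussTail
  linarith

private lemma gaussTail_add (x d : ℝ) :
    gaussTail (x + d) = ∫ t in Set.Ioi x, gaussDensity (t + d) := by
  unfold gaussTail
  rw [← (measurePreserving_add_right volume d).setIntegral_preimage_emb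
    (measurableEmbedding_addRight d)]
  simp

private lemma gaussTail_pos (x : ℝ) : 0 < gaussTail x := by
  unfold gaussTail
  rw [setIntegral_pos_iff_support_of_nonneg_ae
    (Filter.Eventually.of_forall fun t => (gaussDensity_pos t).le)
    integrable_gaussDensity.integrableOn]
  have : Function.support gaussDensity = Set.univ :=
    Set.eq_univ_of_forall fun t => (gaussDensity_pos t).ne'
  simp [this]

private lemma gaussTail_eq_add {a b : ℝ} :
    gaussTail a = (∫ t in a..b, gaussDensity t) + gaussTail b := by
  have := intervalIntegral.integral_interval_add_Ioi
    (integrable_gaussDensity.integrableOn (s := Set.Ioi a))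
    (integrable_gaussDensity.integrableOn (s := Set.Ioi b))
  exact this.symm

/-- Strict log-concavity of the normal tail, in product form. -/
private lemma gaussTail_mul_lt {x₁ x₂ d : ℝ} (hx : x₁ < x₂) (hd : 0 < d) :
    gaussTail (x₂ + d) * gaussTail x₁ < gaussTail x₂ * gaussTail (x₁ + d) := by
  set r := Real.exp (-x₂ * d - d ^ 2 / 2) with hr
  have h_tail : gaussTail (x₂ + d) ≤ r * gaussTail x₂ := by
    rw [gaussTail_add, gaussTail, ← integral_const_mul]
    refine setIntegral_mono_on (integrable_gaussDensity.comp_add_right d).integrableOn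
      (integrable_gaussDensity.const_mul r).integrableOn measurableSet_Ioi fun t ht => ?_
    rw [gaussDensity_add]
    have ht' : x₂ < t := ht
    exact mul_le_mul_of_nonneg_right (Real.exp_le_exp.2 (by nlinarith)) (gaussDensity_pos t).le
  have h_shift : ∫ t in (x₁ + d)..(x₂ + d), gaussDensity t
      = ∫ t in x₁..x₂, gaussDensity (t + d) := by simp
  have h_int : r * (∫ t in x₁..x₂, gaussDensity t)
      < ∫ t in (x₁ + d)..(x₂ + d), gaussDensity t := by
    rw [h_shift, ← intervalIntegral.integral_const_mul]
    refine intervalIntegral.integral_lt_integral_of_continuousOn_of_le_of_exists_lt hx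
      (continuous_gaussDensity.const_mul r).continuousOn
      (continuous_gaussDensity.comp (continuous_add_const d)).continuousOn
      (fun t ht => ?_) ⟨x₁, Set.left_mem_Icc.2 hx.le, ?_⟩
    · rw [gaussDensity_add]
      exact mul_le_mul_of_nonneg_right (Real.exp_le_exp.2 (by nlinarith [ht.2]))
        (gaussDensity_pos t).le
    · rw [gaussDensity_add]
      exact mul_lt_mul_of_pos_right (Real.exp_lt_exp.2 (by nlinarith)) (gaussDensity_pos x₁)
  have h_nonneg : 0 ≤ ∫ t in x₁..x₂, gaussDensity t :=
    intervalIntegral.integral_nonneg hx.le fun t _ => (gaussDensity_pos t).le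
  rw [gaussTail_eq_add (a := x₁) (b := x₂), gaussTail_eq_add (a := x₁ + d) (b := x₂ + d)]
  have h₁ := mul_le_mul_of_nonneg_right h_tail h_nonneg
  have h₂ := mul_lt_mul_of_pos_left h_int (gaussTail_pos x₂)
  nlinarith

/-- Monotonicity of the tail false discovery rate in the normal
means model: let `Φ` be the standard normal CDF, `Φ̄ = 1 − Φ`, and for
`Θ : Fin m → ℝ` with at least one `Θ i ≤ 0` define
`Fdr y = ∑_{i : Θ i ≤ 0} Φ̄(y − Θ i) / ∑_i Φ̄(y − Θ i)`. Then `Fdr` is nonincreasing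
on `ℝ`; if in addition some `Θ j > 0`, it is strictly decreasing. -/
theorem normal_tail_Fdr_monotone
    (m : ℕ) (hm : 0 < m) (Θ : Fin m → ℝ)
    (h0 : ∃ i, Θ i ≤ 0)
    (Phi : ℝ → ℝ)
    (hPhi : ∀ x, Phi x = ∫ t in Set.Iic x, Real.exp (-t ^ 2 / 2) / Real.sqrt (2 * Real.pi))
    (Phibar : ℝ → ℝ) (hPhibar : ∀ x, Phibar x = 1 - Phi x)
    (Fdr : ℝ → ℝ)
    (hFdr : ∀ y, Fdr y =
      (∑ i : Fin m, if Θ i ≤ 0 then Phibar (y - Θ i) else 0)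
        / ∑ i : Fin m, Phibar (y - Θ i)) :
    (∀ y y', y ≤ y' → Fdr y' ≤ Fdr y) ∧
    ((∃ j, 0 < Θ j) → ∀ y y', y < y' → Fdr y' < Fdr y) := by
  have h_tail : ∀ x, Phibar x = gaussTail x := fun x => by
    rw [hPhibar, hPhi]
    exact one_sub_integral_Iic_gaussDensity x
  obtain ⟨i₀, hi₀⟩ := h0
  simp only [h_tail] at hFdr
  set N : ℝ → ℝ := fun y => ∑ i, if Θ i ≤ 0 then gaussTail (y - Θ i) else 0 with hN
  set A : ℝ → ℝ := fun y => ∑ i, if Θ i ≤ 0 then 0 else gaussTail (y - Θ i) with hA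
  have h_sum : ∀ y, ∑ i, gaussTail (y - Θ i) = N y + A y := fun y => by
    simp only [hN, hA, ← Finset.sum_add_distrib]
    exact Finset.sum_congr rfl fun i _ => by split_ifs <;> simp
  have hFdr' : ∀ y, Fdr y = N y / (N y + A y) := fun y => by rw [hFdr, h_sum]
  have h_pos : ∀ y, 0 < N y + A y := fun y => by
    rw [← h_sum]
    exact Finset.sum_pos (fun i _ => gaussTail_pos _) ⟨i₀, Finset.mem_univ _⟩
  have h_strict : (∃ j, 0 < Θ j) → ∀ y y', y < y' → Fdr y' < Fdr y := by
    rintro ⟨j₀, hj₀⟩ y y' hy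
    have h_pair : ∀ i j, Θ i ≤ 0 → 0 < Θ j → gaussTail (y' - Θ i) * gaussTail (y - Θ j)
        < gaussTail (y - Θ i) * gaussTail (y' - Θ j) := fun i j hi hj => by
      have h := gaussTail_mul_lt (x₁ := y - Θ j) (x₂ := y - Θ i) (d := y' - y)
        (by linarith) (by linarith)
      rwa [show y - Θ i + (y' - y) = y' - Θ i by ring,
        show y - Θ j + (y' - y) = y' - Θ j by ring] at h
    have h_cross : N y' * A y < N y * A y' := by
      simp only [hN, hA, Finset.sum_mul_sum, ← Finset.sum_product']
      refine Finset.sum_lt_sum (fun p _ => ?_) ⟨(i₀, j₀), by simp, ?_⟩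
      · split_ifs with hi hj
        · simp
        · exact (h_pair _ _ hi (not_le.1 hj)).le
        · simp
        · simp
      · simpa only [if_pos hi₀, if_neg hj₀.not_ge] using h_pair i₀ j₀ hi₀ hj₀
    rw [hFdr', hFdr', div_lt_div_iff₀ (h_pos y') (h_pos y)]
    linarith
  refine ⟨fun y y' hy => ?_, h_strict⟩
  rcases hy.eq_or_lt with rfl | hlt
  · exact le_rfl
  by_cases hj : ∃ j, 0 < Θ j
  · exact (h_strict hj y y' hlt).le
  · push Not at hj
    have hA0 : ∀ z, A z = 0 := fun z => by simp [hA, hj]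
    have h_one : ∀ z, Fdr z = 1 := fun z => by
      have := h_pos z
      rw [hA0, add_zero] at this
      rw [hFdr', hA0, add_zero, div_self this.ne']
    rw [h_one, h_one]
end
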